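/- There exists a computable map T'' on the Cantor space X over the alphabet ({0,1,S} × {a,b}) such that: (i) T'' has a metric attractor A_m ⊆ X with respect to the uniform Bernoulli product measure on X whose inner collection {w : [w] ∩ A_m ≠ ∅} is Π₂ and such that Tot many-one reduces to it; and (ii) T'' has a topological attractor A_t ⊆ X whose inner collection {w : [w] ∩ A_t ≠ ∅} is a decidable (computable) set of words. -/

import Mathlib

open Filter Topology MeasureTheory Set
open scoped ENNReal NNReal

/-- Cylinder of a finite word in Cantor space: the set of sequences beginning with `w`. -/
def cyl {𝒜 : Type*} (w : List 𝒜) : Set (ℕ → 𝒜) :=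
  {x | ∀ i : Fin w.length, x i = w.get i}

/-- The shift map on Cantor space. -/
def shiftMap {𝒜 : Type*} (x : ℕ → 𝒜) : ℕ → 𝒜 := fun i => x (i + 1)

/-- ω-limit set of `x` under iteration of `T`: the set of accumulation points of the orbit. -/
def omegaSet {X : Type*} [TopologicalSpace X] (T : X → X) (x : X) : Set X :=
  {y | MapClusterPt y Filter.atTop fun n => T^[n] x}

/-- Realm of attraction `ρ(A) = {x : ω(x) ⊆ A}`. -/
def realm {X : Type*} [TopologicalSpace X] (T : X → X) (A : Set X) : Set X :=
  {x | omegaSet T x ⊆ A}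

/-- `A` is a topological attractor of `T`: a closed invariant set whose realm of attraction is
residual, and such that no strictly smaller closed subset has nonmeager realm of attraction. -/
def IsTopAttractor {X : Type*} [TopologicalSpace X] (T : X → X) (A : Set X) : Prop :=
  IsClosed A ∧ Set.MapsTo T A A ∧ realm T A ∈ residual X ∧
    ∀ A' : Set X, IsClosed A' → A' ⊂ A → IsMeagre (realm T A')

/-- `A` is a metric attractor of `T` w.r.t. `lam`: a closed invariant set whose realm of
attraction has full measure, and no strictly smaller closed subset has realm of positive
measure. -/
def IsMetricAttractor {X : Type*} [TopologicalSpace X] [MeasurableSpace X]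
    (T : X → X) (lam : Measure X) (A : Set X) : Prop :=
  IsClosed A ∧ Set.MapsTo T A A ∧ lam (realm T A) = 1 ∧
    ∀ A' : Set X, IsClosed A' → A' ⊂ A → lam (realm T A') = 0

/-- Empirical (Birkhoff) measures `ν_n(x) = (1/n) ∑_{i<n} δ_{T^i x}`. -/
noncomputable def empMeasure {X : Type*} [MeasurableSpace X] (T : X → X) (x : X) (n : ℕ) :
    Measure X :=
  (n : ℝ≥0∞)⁻¹ • ∑ i ∈ Finset.range n, Measure.dirac (T^[i] x)

/-- Weak-* convergence of a sequence of measures: integrals of continuous functions converge. -/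
def WeakTendsto {X : Type*} [TopologicalSpace X] [MeasurableSpace X]
    (μs : ℕ → Measure X) (μ : Measure X) : Prop :=
  ∀ φ : C(X, ℝ), Filter.Tendsto (fun n => ∫ x, φ x ∂(μs n)) Filter.atTop (nhds (∫ x, φ x ∂μ))

/-- Topological support of a measure: points all of whose open neighbourhoods have positive
measure. -/
def measSupport {X : Type*} [TopologicalSpace X] [MeasurableSpace X]
    (μ : Measure X) : Set X :=
  {x | ∀ U : Set X, IsOpen U → x ∈ U → 0 < μ U}

/-- `A` is a statistical (physical) attractor of `T` w.r.t. `lam`: there is a `T`-invariant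
probability measure `μ` with support `A` such that for `lam`-a.e. `x` the empirical measures
converge weak-* to `μ`. -/
def IsStatAttractor {X : Type*} [TopologicalSpace X] [MeasurableSpace X]
    (T : X → X) (lam : Measure X) (A : Set X) : Prop :=
  IsClosed A ∧ ∃ μ : Measure X, IsProbabilityMeasure μ ∧
    Measure.map T μ = μ ∧ measSupport μ = A ∧
    ∀ᵐ x ∂lam, WeakTendsto (empMeasure T x) μ

/-- `A` is strongly attracting: there is an open `U ⊇ A` with `T (closure U) ⊆ U` and
`A = ⋂ₙ Tⁿ(U)`. -/
def StronglyAttracting {X : Type*} [TopologicalSpace X] (T : X → X) (A : Set X) : Prop :=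
  ∃ U : Set X, IsOpen U ∧ A ⊆ U ∧ T '' (closure U) ⊆ U ∧ A = ⋂ n : ℕ, T^[n] '' U

/-- `S` is Σ₁ (recursively enumerable). -/
def SigmaOne {I : Type*} [Primcodable I] (S : Set I) : Prop :=
  ∃ f : I × ℕ → Bool, Computable f ∧ ∀ i, i ∈ S ↔ ∃ a, f (i, a) = true

/-- `S` is Π₁ (co-r.e.). -/
def PiOne {I : Type*} [Primcodable I] (S : Set I) : Prop := SigmaOne Sᶜ

/-- `S` is Σ₂. -/
def SigmaTwo {I : Type*} [Primcodable I] (S : Set I) : Prop :=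
  ∃ f : I × ℕ × ℕ → Bool, Computable f ∧ ∀ i, i ∈ S ↔ ∃ a, ∀ b, f (i, a, b) = true

/-- `S` is Π₂. -/
def PiTwo {I : Type*} [Primcodable I] (S : Set I) : Prop :=
  ∃ f : I × ℕ × ℕ → Bool, Computable f ∧ ∀ i, i ∈ S ↔ ∀ a, ∃ b, f (i, a, b) = true

/-- A map of Cantor space is computable if `(T x) n` is computed by a computable function from
`n` and the finite prefix `[x 0, …, x (α n)]` of `x`, for a computable modulus `α`. -/
def CantorComputable {𝒜 : Type} [Primcodable 𝒜] (T : (ℕ → 𝒜) → (ℕ → 𝒜)) : Prop :=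
  ∃ (α : ℕ → ℕ) (β : ℕ → List 𝒜 → 𝒜), Computable α ∧ Computable₂ β ∧
    ∀ (x : ℕ → 𝒜) (n : ℕ), T x n = β n (List.ofFn fun i : Fin (α n + 1) => x i)

/-- A Borel probability measure on Cantor space is computable if the measures of finite unions
of cylinders are uniformly lower-computable: `lam(⋃_{w ∈ W} [w]) = sup_k q (W, k)` for a
computable `q`. -/
def ComputableCantorMeasure {𝒜 : Type} [Primcodable 𝒜] [MeasurableSpace 𝒜]
    (lam : Measure (ℕ → 𝒜)) : Prop :=
  ∃ q : List (List 𝒜) × ℕ → ℚ, Computable q ∧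
    ∀ W : List (List 𝒜), (lam (⋃ w ∈ W, cyl w)).toReal = ⨆ k, (q (W, k) : ℝ)

/-- Indices of machines halting on input 0. -/
def HaltSet : Set ℕ := {e | ((Denumerable.ofNat Nat.Partrec.Code e).eval 0).Dom}

/-- Indices of total machines. -/
def TotSet : Set ℕ := {e | ∀ n, ((Denumerable.ofNat Nat.Partrec.Code e).eval n).Dom}

/-- Indices of machines with finite domain. -/
def FinSet : Set ℕ := {e | {n | ((Denumerable.ofNat Nat.Partrec.Code e).eval n).Dom}.Finite}

section Sequences

variable {α : Type*}

theorem shiftMap_iterate (x : ℕ → α) (n i : ℕ) : shiftMap^[n] x i = x (i + n) := by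
  induction n generalizing x with
  | zero => rfl
  | succ n ih => rw [Function.iterate_succ_apply, ih, shiftMap, Nat.add_assoc]

theorem mem_cyl_iff_getElem {w : List α} {x : ℕ → α} :
    x ∈ cyl w ↔ ∀ i (h : i < w.length), x i = w[i] :=
  ⟨fun h i hi => h ⟨i, hi⟩, fun h i => h i i.2⟩

theorem mem_cyl_map_range {g : ℕ → α} {n : ℕ} {x : ℕ → α} :
    x ∈ cyl ((List.range n).map g) ↔ ∀ i < n, x i = g i := by
  simp [mem_cyl_iff_getElem]

theorem mem_cyl_iff_eq_map {w : List α} {x : ℕ → α} :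
    x ∈ cyl w ↔ w = (List.range w.length).map x := by
  rw [mem_cyl_iff_getElem]
  constructor
  · intro h
    apply List.ext_getElem (by simp)
    intro i h₁ h₂
    simp [h i h₁]
  · intro h i hi
    conv_rhs => rw [List.getElem_of_eq h]
    simp

variable [TopologicalSpace α] [DiscreteTopology α]

theorem isOpen_cyl (w : List α) : IsOpen (cyl w) := by
  have : cyl w = ⋂ i : Fin w.length, (fun x : ℕ → α => x i) ⁻¹' {w.get i} := by
    ext x
    simp [cyl]
  rw [this]
  exact isOpen_iInter_of_finite fun i => (isOpen_discrete _).preimage (continuous_apply _)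

theorem isClosed_cyl (w : List α) : IsClosed (cyl w) := by
  have : cyl w = ⋂ i : Fin w.length, (fun x : ℕ → α => x i) ⁻¹' {w.get i} := by
    ext x
    simp [cyl]
  rw [this]
  exact isClosed_iInter fun i => (isClosed_discrete _).preimage (continuous_apply _)

theorem exists_agree_subset_of_mem_nhds {x : ℕ → α} {s : Set (ℕ → α)} (hs : s ∈ 𝓝 x) :
    ∃ k, {z | ∀ i < k, z i = x i} ⊆ s := by
  obtain ⟨_, ⟨z, k, rfl⟩, hx, hsub⟩ :=
    (PiNat.isTopologicalBasis_cylinders fun _ : ℕ => α).mem_nhds_iff.1 hs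
  refine ⟨k, fun v hv => hsub ?_⟩
  rw [PiNat.mem_cylinder_iff] at hx ⊢
  exact fun i hi => (hv i hi).trans (hx i hi)

theorem mapClusterPt_atTop_iff_agree {f : ℕ → ℕ → α} {z : ℕ → α} :
    MapClusterPt z atTop f ↔ ∀ k N, ∃ n ≥ N, ∀ i < k, f n i = z i := by
  rw [mapClusterPt_iff_frequently]
  constructor
  · intro h k N
    have hmem : cyl ((List.range k).map z) ∈ 𝓝 z :=
      (isOpen_cyl _).mem_nhds (mem_cyl_map_range.2 fun _ _ => rfl)
    obtain ⟨n, hn, hz⟩ := frequently_atTop.1 (h _ hmem) N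
    exact ⟨n, hn, mem_cyl_map_range.1 hz⟩
  · intro h s hs
    obtain ⟨k, hk⟩ := exists_agree_subset_of_mem_nhds hs
    refine frequently_atTop.2 fun N => ?_
    obtain ⟨n, hn, hz⟩ := h k N
    exact ⟨n, hn, hk hz⟩

theorem cyl_inter_mapClusterPt_nonempty_iff [Finite α] {f : ℕ → ℕ → α} {w : List α} :
    (cyl w ∩ {z | MapClusterPt z atTop f}).Nonempty ↔ ∀ N, ∃ n ≥ N, f n ∈ cyl w := by
  rw [← frequently_atTop]
  constructor
  · rintro ⟨z, hw, hz⟩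
    exact hz.frequently ((isOpen_cyl w).mem_nhds hw)
  · intro h
    obtain ⟨z, hz, hc⟩ := (isClosed_cyl w).isCompact.exists_mapClusterPt_of_frequently h
    exact ⟨z, hz, hc⟩

theorem isClosed_omegaSet {X : Type*} [TopologicalSpace X] (T : X → X) (x : X) :
    IsClosed (omegaSet T x) :=
  isClosed_setOfPred_clusterPt

/-- Orbits that agree with a shift orbit, up to a delay, on longer and longer prefixes have the
same accumulation points as the shift orbit. -/
theorem omegaSet_eq_of_agree_shift {T : (ℕ → α) → ℕ → α} {x y : ℕ → α} (d : ℕ)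
    (h : ∀ k, ∃ N, ∀ n ≥ N, ∀ i < k, T^[n] x i = y (i + n + d)) :
    omegaSet T x = omegaSet shiftMap y := by
  ext z
  simp only [omegaSet, Set.mem_ofPred_eq, mapClusterPt_atTop_iff_agree, shiftMap_iterate]
  constructor
  · intro hz k N
    obtain ⟨M, hM⟩ := h k
    obtain ⟨n, hn, hi⟩ := hz k (max M N)
    refine ⟨n + d, by omega, fun i hik => ?_⟩
    rw [← Nat.add_assoc, ← hM n (by omega) i hik, hi i hik]
  · intro hz k N
    obtain ⟨M, hM⟩ := h k
    obtain ⟨n, hn, hi⟩ := hz k (max M N + d)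
    refine ⟨n - d, by omega, fun i hik => ?_⟩
    rw [hM _ (by omega) i hik, ← hi i hik]
    congr 1
    omega

end Sequences

/-- The separator symbol. -/
def marker : Fin 3 × Fin 2 := (2, 0)

/-- Local rule of `sweepMap`: `l` is a prefix of the state of length at least `2 * i + 4`. -/
def sweepRule (y : ℕ → Fin 3 × Fin 2) (i : ℕ) (l : List (Fin 3 × Fin 2)) : Fin 3 × Fin 2 :=
  if i + 1 < l.idxOf marker then l.getD (i + 1) marker
  else if i = l.idxOf marker + 1 then marker
  else if l.idxOf marker + 2 ≤ i then l.getD i marker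
  else if l.idxOf marker < (l.drop (l.idxOf marker + 1)).idxOf marker then
    l.getD (i + l.idxOf marker + 1) marker
  else y (l.idxOf marker + i + 1)

/-- On a state `p · marker · r`, drop the first symbol of `p`, append two symbols to `p`, and let
the marker move one cell to the right. The appended symbols are read off from the sequence `y`,
unless `r` starts with a marker-free block longer than `p`, in which case they are read off
from `r`. -/
def sweepMap (y : ℕ → Fin 3 × Fin 2) (x : ℕ → Fin 3 × Fin 2) (i : ℕ) : Fin 3 × Fin 2 :=
  sweepRule y i (List.ofFn fun j : Fin (2 * i + 3 + 1) => x j)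

/-- The first marker of `x` is at position `s`. -/
def FirstMarkerAt (x : ℕ → Fin 3 × Fin 2) (s : ℕ) : Prop :=
  x s = marker ∧ ∀ j < s, x j ≠ marker

/-- No marker occurs in the cells `s + 1, …, 2 * s + 1`. -/
def FreeBlock (x : ℕ → Fin 3 × Fin 2) (s : ℕ) : Prop :=
  ∀ j, s < j → j ≤ 2 * s + 1 → x j ≠ marker

theorem lt_idxOf_iff {α : Type*} [BEq α] [LawfulBEq α] (l : List α) (a : α) (n : ℕ)
    (hn : n < l.length) :
    n < l.idxOf a ↔ ∀ j (h : j < l.length), j ≤ n → l[j] ≠ a := by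
  constructor
  · intro h j hj hjn
    simpa using List.not_of_lt_findIdx (lt_of_le_of_lt hjn h)
  · intro h
    by_contra! hc
    exact h _ (hc.trans_lt hn) hc (List.getElem_idxOf _)

section Sweep

variable {y x : ℕ → Fin 3 × Fin 2} {s : ℕ}

theorem sweepMap_of_lt {i : ℕ} (h : ∀ j ≤ i + 1, x j ≠ marker) :
    sweepMap y x i = x (i + 1) := by
  have hs : i + 1 < (List.ofFn fun j : Fin (2 * i + 3 + 1) => x j).idxOf marker := by
    rw [lt_idxOf_iff _ _ _ (by simp only [List.length_ofFn]; omega)]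
    intro j _ hj
    rw [List.getElem_ofFn]
    exact h j hj
  rw [sweepMap, sweepRule, if_pos hs, List.getD_eq_getElem _ _ (by simp only [List.length_ofFn]; omega),
    List.getElem_ofFn]

theorem idxOf_ofFn_of_firstMarkerAt (h : FirstMarkerAt x s) {n : ℕ} (hs : s < n) :
    (List.ofFn fun j : Fin n => x j).idxOf marker = s := by
  apply le_antisymm
  · by_contra! hc
    rw [lt_idxOf_iff _ _ _ (by simpa using hs)] at hc
    exact hc s (by simpa using hs) le_rfl (by simpa using h.1)
  · rcases Nat.eq_zero_or_pos s with rfl | h0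
    · simp
    · have : s - 1 < (List.ofFn fun j : Fin n => x j).idxOf marker := by
        rw [lt_idxOf_iff _ _ _ (by simp only [List.length_ofFn]; omega)]
        intro j _ hj
        simpa using h.2 j (by omega)
      omega

theorem sweepMap_succ (h : FirstMarkerAt x s) : sweepMap y x (s + 1) = marker := by
  rw [sweepMap, sweepRule, idxOf_ofFn_of_firstMarkerAt h (by omega), if_neg (by omega),
    if_pos rfl]

theorem sweepMap_of_gt (h : FirstMarkerAt x s) {i : ℕ} (hi : s + 2 ≤ i) :
    sweepMap y x i = x i := by
  rw [sweepMap, sweepRule, idxOf_ofFn_of_firstMarkerAt h (by omega), if_neg (by omega),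
    if_neg (by omega), if_pos hi, List.getD_eq_getElem _ _ (by simp only [List.length_ofFn]; omega),
    List.getElem_ofFn]

theorem freeBlock_iff_lt_idxOf_drop {n : ℕ} (hn : 2 * s + 1 < n) :
    s < ((List.ofFn fun j : Fin n => x j).drop (s + 1)).idxOf marker ↔ FreeBlock x s := by
  rw [lt_idxOf_iff _ _ _ (by simp only [List.length_drop, List.length_ofFn]; omega)]
  simp only [List.length_drop, List.length_ofFn, List.getElem_drop, List.getElem_ofFn]
  constructor
  · intro h j h₁ h₂
    have := h (j - (s + 1)) (by omega) (by omega)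
    rwa [Nat.add_sub_cancel' (by omega)] at this
  · intro h j h₁ h₂
    exact h _ (by omega) (by omega)

theorem sweepMap_of_freeBlock (h : FirstMarkerAt x s) (hf : FreeBlock x s) {i : ℕ} (hi : i ≤ s)
    (hs : s ≤ i + 1) : sweepMap y x i = x (i + s + 1) := by
  rw [sweepMap, sweepRule, idxOf_ofFn_of_firstMarkerAt h (by omega), if_neg (by omega),
    if_neg (by omega), if_neg (by omega),
    if_pos ((freeBlock_iff_lt_idxOf_drop (by omega)).2 hf),
    List.getD_eq_getElem _ _ (by simp only [List.length_ofFn]; omega),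
    List.getElem_ofFn]

theorem sweepMap_of_not_freeBlock (h : FirstMarkerAt x s) (hf : ¬ FreeBlock x s) {i : ℕ}
    (hi : i ≤ s) (hs : s ≤ i + 1) : sweepMap y x i = y (s + i + 1) := by
  rw [sweepMap, sweepRule, idxOf_ofFn_of_firstMarkerAt h (by omega), if_neg (by omega),
    if_neg (by omega), if_neg (by omega),
    if_neg (mt (freeBlock_iff_lt_idxOf_drop (by omega)).1 hf)]

theorem continuous_sweepMap : Continuous (sweepMap y) := by
  refine continuous_pi fun i => ?_
  have : Continuous fun x : ℕ → Fin 3 × Fin 2 => fun j : Fin (2 * i + 3 + 1) => x j :=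
    continuous_pi fun j => continuous_apply _
  exact (continuous_of_discreteTopology
    (f := fun v : Fin (2 * i + 3 + 1) → Fin 3 × Fin 2 => sweepRule y i (List.ofFn v))).comp this

theorem FirstMarkerAt.sweepMap (hy : ∀ n, y n ≠ marker) (h : FirstMarkerAt x s) :
    FirstMarkerAt (sweepMap y x) (s + 1) := by
  refine ⟨sweepMap_succ h, fun i hi => ?_⟩
  by_cases h₁ : i + 1 < s
  · rw [sweepMap_of_lt fun j hj => h.2 j (by omega)]
    exact h.2 _ h₁
  · by_cases hf : FreeBlock x s
    · rw [sweepMap_of_freeBlock h hf (by omega) (by omega)]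
      exact hf _ (by omega) (by omega)
    · rw [sweepMap_of_not_freeBlock h hf (by omega) (by omega)]
      exact hy _

theorem FirstMarkerAt.iterate (hy : ∀ n, y n ≠ marker) (h : FirstMarkerAt x s) (n : ℕ) :
    FirstMarkerAt ((_root_.sweepMap y)^[n] x) (s + n) ∧
      ∀ i, s + n < i → (_root_.sweepMap y)^[n] x i = x i := by
  induction n with
  | zero => exact ⟨h, fun _ _ => rfl⟩
  | succ n ih =>
    rw [Function.iterate_succ_apply']
    refine ⟨ih.1.sweepMap hy, fun i hi => ?_⟩
    rw [sweepMap_of_gt ih.1 (by omega), ih.2 i (by omega)]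

theorem FirstMarkerAt.freeBlock_iterate (hy : ∀ n, y n ≠ marker) (h : FirstMarkerAt x s) (n : ℕ) :
    FreeBlock ((_root_.sweepMap y)^[n] x) (s + n) ↔ FreeBlock x (s + n) :=
  forall_congr' fun j => forall_congr' fun hj => forall_congr' fun _ => by
    rw [(h.iterate hy n).2 j hj]

theorem FirstMarkerAt.iterate_eq_of_appended (hy : ∀ n, y n ≠ marker) (h : FirstMarkerAt x s)
    {z : ℕ → Fin 3 × Fin 2}
    (hz : ∀ n i, i ≤ s + n → s + n ≤ i + 1 →
      _root_.sweepMap y ((_root_.sweepMap y)^[n] x) i = z (i + n + 1 + s))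
    (n : ℕ) : ∀ i, i < s + n → s + 1 ≤ i + n →
      (_root_.sweepMap y)^[n] x i = z (i + n + s) := by
  induction n with
  | zero => intro i _ _; omega
  | succ n ih =>
    intro i h₁ h₂
    rw [Function.iterate_succ_apply']
    by_cases hi : i + 1 < s + n
    · rw [sweepMap_of_lt fun j hj => (h.iterate hy n).1.2 j (by omega), ih _ hi (by omega)]
      congr 1
      omega
    · exact hz n i (by omega) (by omega)

theorem FirstMarkerAt.iterate_eq_of_not_freeBlock (hy : ∀ n, y n ≠ marker) (h : FirstMarkerAt x s)
    (hf : ∀ n, ¬ FreeBlock x (s + n)) (n i : ℕ) (h₁ : i < s + n) (h₂ : s + 1 ≤ i + n) :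
    (_root_.sweepMap y)^[n] x i = y (i + n + s) := by
  refine h.iterate_eq_of_appended hy (fun n i h₁ h₂ => ?_) n i h₁ h₂
  rw [sweepMap_of_not_freeBlock (h.iterate hy n).1
    (mt (h.freeBlock_iterate hy n).1 (hf n)) h₁ h₂]
  congr 1
  omega

theorem FirstMarkerAt.iterate_eq_of_freeBlock (hy : ∀ n, y n ≠ marker) (h : FirstMarkerAt x s)
    (hf : ∀ j, s < j → x j ≠ marker) (n i : ℕ) (h₁ : i < s + n) (h₂ : s + 1 ≤ i + n) :
    (_root_.sweepMap y)^[n] x i = x (i + n + s) := by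
  refine h.iterate_eq_of_appended hy (fun n i h₁ h₂ => ?_) n i h₁ h₂
  rw [sweepMap_of_freeBlock (h.iterate hy n).1
    ((h.freeBlock_iterate hy n).2 fun j hj _ => hf j (by omega)) h₁ h₂,
    (h.iterate hy n).2 _ (by omega)]
  congr 1
  omega

/-- If the marker is present and only finitely many free blocks occur, then the orbit displays
the sequence `y`. -/
theorem FirstMarkerAt.omegaSet_eq (hy : ∀ n, y n ≠ marker) (h : FirstMarkerAt x s) {N : ℕ}
    (hN : ∀ n ≥ N, ¬ FreeBlock x n) :
    omegaSet (_root_.sweepMap y) x = omegaSet shiftMap y := by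
  have hfree : ∀ n, ¬ FreeBlock ((_root_.sweepMap y)^[N] x) (s + N + n) := by
    intro n hf
    refine hN (s + N + n) (by omega) fun j h₁ h₂ => ?_
    rw [← (h.iterate hy N).2 j (by omega)]
    exact hf j h₁ h₂
  refine omegaSet_eq_of_agree_shift s fun k => ⟨s + 2 * N + k + 1, fun n hn i hi => ?_⟩
  have := (h.iterate hy N).1.iterate_eq_of_not_freeBlock hy hfree (n - N) i (by omega) (by omega)
  rw [← Function.iterate_add_apply, Nat.sub_add_cancel (by omega)] at this
  rw [this]
  congr 1
  omega

/-- The sequences without marker. -/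
def markerFree : Set (ℕ → Fin 3 × Fin 2) := {x | ∀ i, x i ≠ marker}

theorem isClosed_markerFree : IsClosed markerFree := by
  have : markerFree = ⋂ i : ℕ, (fun x : ℕ → Fin 3 × Fin 2 => x i) ⁻¹' {marker}ᶜ := by
    ext x
    simp [markerFree]
  rw [this]
  exact isClosed_iInter fun i => (isClosed_discrete _).preimage (continuous_apply _)

theorem sweepMap_of_markerFree (h : x ∈ markerFree) : sweepMap y x = shiftMap x :=
  funext fun _ => sweepMap_of_lt fun j _ => h j

theorem mapsTo_sweepMap_markerFree : MapsTo (sweepMap y) markerFree markerFree := by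
  intro x hx
  rw [sweepMap_of_markerFree hx]
  exact fun i => hx (i + 1)

theorem omegaSet_sweepMap_subset (hy : ∀ n, y n ≠ marker) (x : ℕ → Fin 3 × Fin 2) :
    omegaSet (sweepMap y) x ⊆ markerFree := by
  intro z hz i hi
  rw [omegaSet, Set.mem_ofPred_eq, mapClusterPt_atTop_iff_agree] at hz
  by_cases h : ∃ s, x s = marker
  · classical
    have hf : FirstMarkerAt x (Nat.find h) := ⟨Nat.find_spec h, fun j hj => Nat.find_min h hj⟩
    obtain ⟨n, hn, hag⟩ := hz (i + 1) (i + 1)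
    exact (hf.iterate hy n).1.2 i (by omega) ((hag i (by omega)).trans hi)
  · push Not at h
    obtain ⟨n, -, hag⟩ := hz (i + 1) 0
    exact mapsTo_sweepMap_markerFree.iterate n (x := x) h i ((hag i (by omega)).trans hi)

theorem dense_visits (hy : ∀ n, y n ≠ marker) {w : List (Fin 3 × Fin 2)}
    (hw : marker ∉ w) (N : ℕ) :
    Dense {x | ∃ n ≥ N, (sweepMap y)^[n] x ∈ cyl w} := by
  classical
  rw [dense_iff_inter_open]
  rintro U hU ⟨u, hu⟩
  obtain ⟨k, hk⟩ := exists_agree_subset_of_mem_nhds (hU.mem_nhds hu)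
  obtain ⟨t, ht⟩ : ∃ t, t = 3 * k + N + w.length + 1 := ⟨_, rfl⟩
  have key : ∀ s ≤ k, ∀ x : ℕ → Fin 3 × Fin 2, FirstMarkerAt x s →
      (∀ j, k < j → x j = w.getD (j - (t + s)) (0, 0)) → (sweepMap y)^[t] x ∈ cyl w := by
    intro s hs x hx hxw
    rw [mem_cyl_iff_getElem]
    intro i hi
    have hne : ∀ j, (w.getD j (0, 0)) ≠ marker := by
      intro j hj
      by_cases hjl : j < w.length
      · rw [List.getD_eq_getElem _ _ hjl] at hj
        exact hw (hj ▸ List.getElem_mem _)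
      · rw [List.getD_eq_default _ _ (by omega)] at hj
        exact absurd hj (by decide)
    have hit := hx.iterate hy k
    have := hit.1.iterate_eq_of_freeBlock hy (fun j hj => by
      rw [hit.2 j hj, hxw j (by omega)]
      exact hne _) (t - k) i (by omega) (by omega)
    rw [← Function.iterate_add_apply, Nat.sub_add_cancel (by omega)] at this
    rw [this, hit.2 _ (by omega), hxw _ (by omega),
      show i + (t - k) + (s + k) - (t + s) = i by omega, List.getD_eq_getElem _ _ hi]
  let x (s j : ℕ) : Fin 3 × Fin 2 :=
    if j < k then u j else if j = k then marker else w.getD (j - (t + s)) (0, 0)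
  have hmark : ∃ s, x 0 s = marker := ⟨k, by simp [x]⟩
  have hs : Nat.find hmark ≤ k := Nat.find_min' hmark (by simp [x])
  have hx0 : ∀ j ≤ k, x (Nat.find hmark) j = x 0 j := by
    intro j hj
    simp only [x]
    split_ifs <;> first | rfl | omega
  refine ⟨x (Nat.find hmark), hk fun i hi => by simp [x, hi], t, by omega,
    key _ hs _ ⟨?_, fun j hj => ?_⟩ fun j hj => ?_⟩
  · rw [hx0 _ hs]
    exact Nat.find_spec hmark
  · rw [hx0 _ (by omega)]
    exact Nat.find_min hmark hj
  · simp [x, show ¬ j < k by omega, show j ≠ k by omega]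

theorem residual_markerFree_subset_omegaSet (hy : ∀ n, y n ≠ marker) :
    {x | markerFree ⊆ omegaSet (sweepMap y) x} ∈ residual (ℕ → Fin 3 × Fin 2) := by
  have hres : ∀ (w : {w : List (Fin 3 × Fin 2) // marker ∉ w}) (N : ℕ),
      ∀ᶠ x in residual (ℕ → Fin 3 × Fin 2), ∃ n ≥ N, (sweepMap y)^[n] x ∈ cyl w.1 := by
    intro w N
    refine residual_of_dense_open ?_ (dense_visits hy w.2 N)
    have : {x | ∃ n ≥ N, (sweepMap y)^[n] x ∈ cyl w.1} =
        ⋃ n ≥ N, (sweepMap y)^[n] ⁻¹' cyl w.1 := by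
      ext x
      simp
    rw [this]
    exact isOpen_biUnion fun n _ => (isOpen_cyl _).preimage (continuous_sweepMap.iterate n)
  filter_upwards [eventually_countable_forall.2 fun w => eventually_countable_forall.2 (hres w)]
    with x hx z hz
  rw [omegaSet, Set.mem_ofPred_eq, mapClusterPt_atTop_iff_agree]
  intro k N
  obtain ⟨n, hn, hmem⟩ := hx ⟨(List.range k).map z, by simpa using fun i _ => hz i⟩ N
  exact ⟨n, hn, mem_cyl_map_range.1 hmem⟩

theorem isTopAttractor_markerFree (hy : ∀ n, y n ≠ marker) :
    IsTopAttractor (sweepMap y) markerFree := by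
  refine ⟨isClosed_markerFree, mapsTo_sweepMap_markerFree,
    univ_mem' fun x => omegaSet_sweepMap_subset hy x, fun A' _ hA => ?_⟩
  rw [IsMeagre]
  filter_upwards [residual_markerFree_subset_omegaSet hy] with x hx hx'
  exact hA.2 (hx.trans hx')

end Sweep
section Measure

variable {lam : Measure (ℕ → Fin 3 × Fin 2)}

theorem measure_freeBlock_le
    (hlam : ∀ w : List (Fin 3 × Fin 2),
      lam (cyl w) = ((Fintype.card (Fin 3 × Fin 2) : ℝ≥0∞))⁻¹ ^ w.length) (n : ℕ) :
    lam {x | FreeBlock x n} ≤ (5 / 6) ^ (n + 1) := by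
  let V : Fin ((n + 1) + (n + 1)) → Finset (Fin 3 × Fin 2) :=
    Fin.append (fun _ => Finset.univ) (fun _ => Finset.univ.erase marker)
  have hcard : (Fintype.piFinset V).card = 6 ^ (n + 1) * 5 ^ (n + 1) := by
    rw [Fintype.card_piFinset, Fin.prod_univ_add]
    simp only [V, Fin.append_left, Fin.append_right, Finset.prod_const,
      Finset.card_erase_of_mem (Finset.mem_univ _), Finset.card_univ, Fintype.card_prod,
      Fintype.card_fin]
  have hsub : {x | FreeBlock x n} ⊆ ⋃ f ∈ Fintype.piFinset V, cyl (List.ofFn f) := by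
    intro x hx
    simp only [Set.mem_iUnion, exists_prop]
    refine ⟨fun i => x i, ?_, fun i => by rw [List.get_eq_getElem, List.getElem_ofFn]⟩
    rw [Fintype.mem_piFinset]
    intro i
    refine Fin.addCases (fun i => ?_) (fun i => ?_) i
    · simp [V]
    · simp only [V, Fin.append_right, Fin.val_natAdd, Finset.mem_erase, Finset.mem_univ, and_true]
      exact hx _ (by omega) (by omega)
  calc lam {x | FreeBlock x n}
      ≤ lam (⋃ f ∈ Fintype.piFinset V, cyl (List.ofFn f)) := measure_mono hsub
    _ ≤ ∑ f ∈ Fintype.piFinset V, lam (cyl (List.ofFn f)) := measure_biUnion_finset_le _ _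
    _ = (6 ^ (n + 1) * 5 ^ (n + 1)) * (6⁻¹ ^ (n + 1) * 6⁻¹ ^ (n + 1)) := by
      simp [hlam, hcard, ← pow_add, Nat.add_assoc]
    _ = (6 * 6⁻¹) ^ (n + 1) * (5 * 6⁻¹) ^ (n + 1) := by
      rw [mul_pow, mul_pow]
      ring
    _ = (5 / 6) ^ (n + 1) := by
      rw [ENNReal.mul_inv_cancel (by norm_num) (by norm_num), one_pow, one_mul, div_eq_mul_inv]

theorem ae_eventually_not_freeBlock
    (hlam : ∀ w : List (Fin 3 × Fin 2),
      lam (cyl w) = ((Fintype.card (Fin 3 × Fin 2) : ℝ≥0∞))⁻¹ ^ w.length) :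
    ∀ᵐ x ∂lam, ∀ᶠ n in atTop, ¬ FreeBlock x n := by
  have hlt : (5 / 6 : ℝ≥0∞) < 1 :=
    ENNReal.div_lt_of_lt_mul (by norm_num)
  refine ae_eventually_notMem (s := fun n => {x | FreeBlock x n}) (ne_top_of_le_ne_top ?_
    (ENNReal.tsum_le_tsum fun n => measure_freeBlock_le hlam n))
  rw [ENNReal.tsum_geometric_add_one]
  exact ENNReal.mul_ne_top (hlt.trans ENNReal.one_lt_top).ne
    (ENNReal.inv_ne_top.2 (tsub_pos_of_lt hlt).ne')

theorem isMetricAttractor_omegaSet_shiftMap {y : ℕ → Fin 3 × Fin 2} (hy : ∀ n, y n ≠ marker)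
    [IsProbabilityMeasure lam]
    (hlam : ∀ w : List (Fin 3 × Fin 2),
      lam (cyl w) = ((Fintype.card (Fin 3 × Fin 2) : ℝ≥0∞))⁻¹ ^ w.length) :
    IsMetricAttractor (sweepMap y) lam (omegaSet shiftMap y) := by
  classical
  have hae : ∀ᵐ x ∂lam, omegaSet (sweepMap y) x = omegaSet shiftMap y := by
    filter_upwards [ae_eventually_not_freeBlock hlam] with x hx
    obtain ⟨N, hN⟩ := eventually_atTop.1 hx
    have hm : ∃ s, x s = marker := by
      by_contra! h
      exact hN N le_rfl fun j _ _ => h j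
    exact FirstMarkerAt.omegaSet_eq hy
      ⟨Nat.find_spec hm, fun j hj => Nat.find_min hm hj⟩ hN
  refine ⟨isClosed_omegaSet _ _, ?_, ?_, fun A' _ hA => ?_⟩
  · intro z hz
    have hfree : z ∈ markerFree := by
      intro i hi
      rw [omegaSet, Set.mem_ofPred_eq, mapClusterPt_atTop_iff_agree] at hz
      obtain ⟨n, -, hag⟩ := hz (i + 1) 0
      rw [← hag i (by omega), shiftMap_iterate] at hi
      exact hy _ hi
    rw [sweepMap_of_markerFree hfree]
    rw [omegaSet, Set.mem_ofPred_eq, mapClusterPt_atTop_iff_agree] at hz ⊢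
    intro k N
    obtain ⟨n, hn, hag⟩ := hz (k + 1) N
    refine ⟨n + 1, by omega, fun i hi => ?_⟩
    rw [Function.iterate_succ_apply']
    exact hag (i + 1) (by omega)
  · rw [← measure_univ (μ := lam)]
    refine measure_congr (eventuallyEq_univ.2 ?_)
    filter_upwards [hae] with x hx
    exact hx.subset
  · rw [measure_eq_zero_iff_ae_notMem]
    filter_upwards [hae] with x hx hx'
    exact hA.2 (hx ▸ hx')

end Measure

/-- The machine of index `e` halts on all inputs up to `n` within `s` steps. -/
def HaltsUpTo (e n s : ℕ) : Prop :=
  ∀ i ∈ List.range (n + 1),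
    (Nat.Partrec.Code.evaln s (Denumerable.ofNat Nat.Partrec.Code e) i).isSome = true

/-- For `k` coding `(e, n, s)`: the machine of index `e` needs exactly `s + 1` steps to halt on
all inputs up to `n`. -/
def IsHaltingStage (k : ℕ) : Prop :=
  HaltsUpTo k.unpair.1 k.unpair.2.unpair.1 (k.unpair.2.unpair.2 + 1) ∧
    ¬ HaltsUpTo k.unpair.1 k.unpair.2.unpair.1 k.unpair.2.unpair.2

open Classical in
/-- The interval `[k ^ 2, (k + 1) ^ 2)` carries the word `0 1 ^ (e + 1) 0 ⋯ 0` if `k = (e, n, s)`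
is a halting stage, and zeros otherwise. -/
noncomputable def haltingSeq (m : ℕ) : Fin 3 × Fin 2 :=
  if (1 ≤ m - m.sqrt * m.sqrt ∧ m - m.sqrt * m.sqrt ≤ m.sqrt.unpair.1 + 1) ∧
    IsHaltingStage m.sqrt then (1, 0) else (0, 0)

theorem haltingSeq_ne_marker (m : ℕ) : haltingSeq m ≠ marker := by
  rw [haltingSeq]
  split_ifs <;> decide

theorem haltingSeq_sq_add {k r : ℕ} (hr : r ≤ 2 * k) :
    haltingSeq (k * k + r) = (1, 0) ↔ (1 ≤ r ∧ r ≤ k.unpair.1 + 1) ∧ IsHaltingStage k := by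
  have hk : (k * k + r).sqrt = k := Nat.sqrt_add_eq k (by omega)
  rw [haltingSeq, hk, Nat.add_sub_cancel_left]
  split_ifs with h
  · simp [h]
  · simp [h]

theorem haltingSeq_eq_or (m : ℕ) : haltingSeq m = (1, 0) ∨ haltingSeq m = (0, 0) := by
  rw [haltingSeq]
  split_ifs <;> simp

/-- The word `0 1 ^ (e + 1) 0`. -/
def indexWord (e : ℕ) : List (Fin 3 × Fin 2) :=
  (List.range (e + 3)).map fun i => if 1 ≤ i ∧ i ≤ e + 1 then (1, 0) else (0, 0)

theorem HaltsUpTo.mono {e n s t : ℕ} (h : HaltsUpTo e n s) (hst : s ≤ t) : HaltsUpTo e n t := by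
  intro i hi
  obtain ⟨a, ha⟩ := Option.isSome_iff_exists.1 (h i hi)
  exact Option.isSome_iff_exists.2 ⟨a, Nat.Partrec.Code.evaln_mono hst ha⟩

theorem not_haltsUpTo_zero (e n : ℕ) : ¬ HaltsUpTo e n 0 := by
  intro h
  have := h 0 (by simp)
  simp [Nat.Partrec.Code.evaln] at this

theorem exists_haltsUpTo {e : ℕ} (he : e ∈ TotSet) (n : ℕ) : ∃ s, HaltsUpTo e n s := by
  have h : ∀ i, ∃ s, (Nat.Partrec.Code.evaln s
      (Denumerable.ofNat Nat.Partrec.Code e) i).isSome = true := by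
    intro i
    obtain ⟨a, ha⟩ := Part.dom_iff_mem.1 (he i)
    obtain ⟨s, hs⟩ := Nat.Partrec.Code.evaln_complete.1 ha
    exact ⟨s, Option.isSome_iff_exists.2 ⟨a, hs⟩⟩
  choose s hs using h
  refine ⟨(Finset.range (n + 1)).sup s, fun i hi => ?_⟩
  obtain ⟨a, ha⟩ := Option.isSome_iff_exists.1 (hs i)
  refine Option.isSome_iff_exists.2 ⟨a, Nat.Partrec.Code.evaln_mono ?_ ha⟩
  exact Finset.le_sup (Finset.mem_range.2 (List.mem_range.1 hi))

theorem mem_totSet_of_haltsUpTo {e : ℕ} (h : ∀ n, ∃ m ≥ n, ∃ s, HaltsUpTo e m s) :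
    e ∈ TotSet := by
  intro n
  obtain ⟨m, hm, s, hs⟩ := h n
  obtain ⟨a, ha⟩ := Option.isSome_iff_exists.1 (hs n (List.mem_range.2 (by omega)))
  exact Part.dom_iff_mem.2 ⟨a, Nat.Partrec.Code.evaln_sound ha⟩

/-- A machine is total iff it has infinitely many halting stages. -/
theorem mem_totSet_iff {e : ℕ} :
    e ∈ TotSet ↔ ∀ N, ∃ k ≥ N, k.unpair.1 = e ∧ IsHaltingStage k := by
  classical
  constructor
  · intro he N
    have h := exists_haltsUpTo he N
    obtain ⟨s, hs⟩ : ∃ s, Nat.find h = s + 1 := by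
      refine Nat.exists_eq_succ_of_ne_zero fun h0 => ?_
      exact not_haltsUpTo_zero e N (h0 ▸ Nat.find_spec h)
    refine ⟨Nat.pair e (Nat.pair N s), ?_, by simp, ?_⟩
    · exact (Nat.left_le_pair N s).trans (Nat.right_le_pair e _)
    · simp only [IsHaltingStage, Nat.unpair_pair]
      exact ⟨hs ▸ Nat.find_spec h, Nat.find_min h (by omega)⟩
  · intro h
    refine mem_totSet_of_haltsUpTo fun n => ?_
    by_contra! hc
    -- The stages with inputs below `n` are bounded by the least halting times.
    have hbound : ∀ m, ∃ B, ∀ k, k.unpair.1 = e → k.unpair.2.unpair.1 = m →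
        IsHaltingStage k → k ≤ B := by
      intro m
      by_cases hk : ∃ k, k.unpair.1 = e ∧ k.unpair.2.unpair.1 = m ∧ IsHaltingStage k
      · obtain ⟨k, hke, hkm, hk⟩ := hk
        refine ⟨k, fun l hle hlm hl => ?_⟩
        rw [IsHaltingStage, hke, hkm] at hk
        rw [IsHaltingStage, hle, hlm] at hl
        have h₁ : ¬ k.unpair.2.unpair.2 + 1 ≤ l.unpair.2.unpair.2 :=
          fun hle => hl.2 (hk.1.mono hle)
        have h₂ : ¬ l.unpair.2.unpair.2 + 1 ≤ k.unpair.2.unpair.2 :=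
          fun hle => hk.2 (hl.1.mono hle)
        rw [← Nat.pair_unpair l, ← Nat.pair_unpair l.unpair.2, hle, hlm,
          ← Nat.pair_unpair k, ← Nat.pair_unpair k.unpair.2, hke, hkm]
        rw [show l.unpair.2.unpair.2 = k.unpair.2.unpair.2 by omega]
      · push Not at hk
        exact ⟨0, fun k h₁ h₂ h₃ => absurd h₃ (hk k h₁ h₂)⟩
    choose B hB using hbound
    obtain ⟨k, hkN, hke, hk⟩ := h ((Finset.range n).sup B + 1)
    by_cases hkn : k.unpair.2.unpair.1 < n
    · have h₁ := hB _ k hke rfl hk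
      have h₂ := Finset.le_sup (f := B) (Finset.mem_range.2 hkn)
      omega
    · exact hc _ (by omega) _ (hke ▸ hk.1)

/-- The word `0 1 ^ (e + 1) 0` occurs infinitely often in `haltingSeq` iff `e` is total. -/
theorem mem_totSet_iff_indexWord {e : ℕ} :
    e ∈ TotSet ↔ (cyl (indexWord e) ∩ omegaSet shiftMap haltingSeq).Nonempty := by
  rw [mem_totSet_iff, omegaSet, cyl_inter_mapClusterPt_nonempty_iff]
  simp only [indexWord, mem_cyl_map_range, shiftMap_iterate]
  constructor
  · intro h N
    obtain ⟨k, hkN, hke, hk⟩ := h (N + e + 2)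
    refine ⟨k * k, by nlinarith, fun i hi => ?_⟩
    have hki := haltingSeq_sq_add (k := k) (r := i) (by omega)
    rw [Nat.add_comm i]
    split_ifs with h₁
    · exact hki.2 ⟨by omega, hk⟩
    · exact (haltingSeq_eq_or _).resolve_left fun h' => h₁ (hke ▸ (hki.1 h').1)
  · intro h N
    obtain ⟨p, hp, hw⟩ := h ((N + e + 2) * (N + e + 2))
    obtain ⟨k, r, hkr, hr⟩ : ∃ k r, p + 1 = k * k + r ∧ r ≤ 2 * k :=
      ⟨(p + 1).sqrt, p + 1 - (p + 1).sqrt * (p + 1).sqrt,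
        (Nat.add_sub_cancel' (Nat.sqrt_le _)).symm, by have := Nat.sqrt_le_add (p + 1); omega⟩
    have hk : N + e + 2 ≤ k := by nlinarith
    have hone : ∀ i, 1 ≤ i → i ≤ e + 1 → haltingSeq (i + p) = (1, 0) := fun i h₁ h₂ => by
      rw [hw i (by omega), if_pos ⟨h₁, h₂⟩]
    have hzero : ∀ i, i = 0 ∨ i = e + 2 → haltingSeq (i + p) ≠ (1, 0) := fun i h₁ => by
      rw [hw i (by omega), if_neg (by omega)]
      decide
    obtain ⟨⟨hr₁, hr₂⟩, hstage⟩ := (haltingSeq_sq_add hr).1 (by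
      rw [← hkr, Nat.add_comm]
      exact hone 1 le_rfl (by omega))
    have hr₀ : r = 1 := by
      by_contra hne
      refine hzero 0 (Or.inl rfl) ?_
      rw [show 0 + p = k * k + (r - 1) by omega, haltingSeq_sq_add (by omega)]
      exact ⟨by omega, hstage⟩
    subst hr₀
    refine ⟨k, by omega, le_antisymm ?_ ?_, hstage⟩
    · by_contra! hlt
      refine hzero (e + 2) (Or.inr rfl) ?_
      rw [show e + 2 + p = k * k + (e + 2) by omega, haltingSeq_sq_add (by omega)]
      exact ⟨by omega, hstage⟩
    · have := hone (e + 1) (by omega) le_rfl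
      rw [show e + 1 + p = k * k + (e + 1) by omega, haltingSeq_sq_add (by omega)] at this
      omega

theorem primrecPred_haltsUpTo :
    PrimrecPred fun p : ℕ × ℕ × ℕ => HaltsUpTo p.1 p.2.1 p.2.2 := by
  have hR : PrimrecRel fun (i : ℕ) (p : ℕ × ℕ × ℕ) =>
      (Nat.Partrec.Code.evaln p.2.2 (Denumerable.ofNat Nat.Partrec.Code p.1) i).isSome = true := by
    refine Primrec.primrecPred (p := fun q : ℕ × ℕ × ℕ × ℕ => (Nat.Partrec.Code.evaln q.2.2.2
      (Denumerable.ofNat Nat.Partrec.Code q.2.1) q.1).isSome = true) ?_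
    simp only [Bool.decide_eq_true]
    exact Primrec.option_isSome.comp (Nat.Partrec.Code.primrec_evaln.comp
      (((Primrec.snd.comp (Primrec.snd.comp Primrec.snd)).pair
        ((Primrec.ofNat _).comp (Primrec.fst.comp Primrec.snd))).pair Primrec.fst))
  exact hR.forall_mem_list.comp
    (Primrec.list_range.comp (Primrec.succ.comp (Primrec.fst.comp Primrec.snd))) Primrec.id

theorem primrecPred_isHaltingStage : PrimrecPred IsHaltingStage := by
  have h₁ : Primrec fun k : ℕ => k.unpair.1 := Primrec.fst.comp Primrec.unpair
  have h₂ : Primrec fun k : ℕ => k.unpair.2.unpair :=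
    Primrec.unpair.comp (Primrec.snd.comp Primrec.unpair)
  exact (primrecPred_haltsUpTo.comp (h₁.pair ((Primrec.fst.comp h₂).pair
    (Primrec.succ.comp (Primrec.snd.comp h₂))))).and
    (primrecPred_haltsUpTo.comp (h₁.pair ((Primrec.fst.comp h₂).pair
      (Primrec.snd.comp h₂)))).not

theorem primrec_haltingSeq : Primrec haltingSeq := by
  classical
  have hr : Primrec fun m : ℕ => m - m.sqrt * m.sqrt :=
    Primrec.nat_sub.comp Primrec.id (Primrec.nat_mul.comp Primrec.nat_sqrt Primrec.nat_sqrt)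
  refine Primrec.ite (((Primrec.nat_le.comp (Primrec.const 1) hr).and
    (Primrec.nat_le.comp hr (Primrec.succ.comp (Primrec.fst.comp
      (Primrec.unpair.comp Primrec.nat_sqrt))))).and
    (primrecPred_isHaltingStage.comp Primrec.nat_sqrt)) (Primrec.const _) (Primrec.const _)

theorem primrec₂_sweepRule {y : ℕ → Fin 3 × Fin 2} (hy : Primrec y) : Primrec₂ (sweepRule y) := by
  have hi : Primrec fun p : ℕ × List (Fin 3 × Fin 2) => p.1 := Primrec.fst
  have hl : Primrec fun p : ℕ × List (Fin 3 × Fin 2) => p.2 := Primrec.snd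
  have hidx : Primrec fun l : List (Fin 3 × Fin 2) => l.idxOf marker := by
    convert Primrec.list_idxOf.comp (Primrec.const marker) Primrec.id using 3
    · subsingleton
    · rfl
  have hs : Primrec fun p : ℕ × List (Fin 3 × Fin 2) => p.2.idxOf marker := hidx.comp hl
  have hd : Primrec fun p : ℕ × List (Fin 3 × Fin 2) =>
      (p.2.drop (p.2.idxOf marker + 1)).idxOf marker :=
    hidx.comp (Primrec.list_drop.comp (Primrec.succ.comp hs) hl)
  exact Primrec.ite (Primrec.nat_lt.comp (Primrec.succ.comp hi) hs)
    ((Primrec.list_getD marker).comp hl (Primrec.succ.comp hi)) <|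
    Primrec.ite (Primrec.eq.comp hi (Primrec.succ.comp hs)) (Primrec.const marker) <|
    Primrec.ite (Primrec.nat_le.comp (Primrec.succ.comp (Primrec.succ.comp hs)) hi)
      ((Primrec.list_getD marker).comp hl hi) <|
    Primrec.ite (Primrec.nat_lt.comp hs hd)
      ((Primrec.list_getD marker).comp hl (Primrec.succ.comp (Primrec.nat_add.comp hi hs)))
      (hy.comp (Primrec.succ.comp (Primrec.nat_add.comp hs hi)))

theorem cantorComputable_sweepMap {y : ℕ → Fin 3 × Fin 2} (hy : Primrec y) :
    CantorComputable (sweepMap y) := by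
  refine ⟨fun i => 2 * i + 3, sweepRule y, ?_, (primrec₂_sweepRule hy).to_comp, fun _ _ => rfl⟩
  exact (Primrec.nat_add.comp (Primrec.nat_mul.comp (Primrec.const 2) Primrec.id)
    (Primrec.const 3)).to_comp

theorem piTwo_cyl_inter_omegaSet_shiftMap {α : Type} [Primcodable α] [DecidableEq α] [Finite α]
    [TopologicalSpace α] [DiscreteTopology α] {y : ℕ → α} (hy : Primrec y) :
    PiTwo {w : List α | (cyl w ∩ omegaSet shiftMap y).Nonempty} := by
  refine ⟨fun p => decide (p.2.1 ≤ p.2.2 ∧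
    p.1 = (List.range p.1.length).map fun i => y (i + p.2.2)), ?_, fun w => ?_⟩
  · have hw : Primrec fun p : List α × ℕ × ℕ => p.1 := Primrec.fst
    have ha : Primrec fun p : List α × ℕ × ℕ => p.2.1 := Primrec.fst.comp Primrec.snd
    have hb : Primrec fun p : List α × ℕ × ℕ => p.2.2 := Primrec.snd.comp Primrec.snd
    exact ((Primrec.nat_le.comp ha hb).and (Primrec.eq.comp hw
      (Primrec.list_map (Primrec.list_range.comp (Primrec.list_length.comp hw))
        (hy.comp (Primrec.nat_add.comp Primrec.snd (hb.comp Primrec.fst))).to₂))).decide.to_comp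
  · rw [Set.mem_ofPred_eq, omegaSet, cyl_inter_mapClusterPt_nonempty_iff]
    simp only [mem_cyl_iff_eq_map, decide_eq_true_eq, ge_iff_le]
    refine forall_congr' fun a => exists_congr fun b => and_congr_right fun _ => ?_
    rw [show shiftMap^[b] y = fun i => y (i + b) from funext (shiftMap_iterate y b)]

theorem primrec_indexWord : Primrec indexWord := by
  refine Primrec.list_map (Primrec.list_range.comp
    (Primrec.nat_add.comp Primrec.id (Primrec.const 3))) ?_
  exact Primrec.ite ((Primrec.nat_le.comp (Primrec.const 1) Primrec.snd).and
    (Primrec.nat_le.comp Primrec.snd (Primrec.succ.comp Primrec.fst)))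
    (Primrec.const _) (Primrec.const _)

theorem computablePred_cyl_inter_markerFree :
    ComputablePred fun w : List (Fin 3 × Fin 2) => (cyl w ∩ markerFree).Nonempty := by
  have h : ∀ w : List (Fin 3 × Fin 2),
      (∀ a ∈ w, a ≠ marker) ↔ (cyl w ∩ markerFree).Nonempty := by
    intro w
    constructor
    · intro hw
      refine ⟨fun i => w.getD i (0, 0), mem_cyl_iff_getElem.2 fun i hi => ?_, fun i => ?_⟩
      · exact List.getD_eq_getElem _ _ hi
      · change w.getD i (0, 0) ≠ marker
        by_cases hi : i < w.length
        · rw [List.getD_eq_getElem _ _ hi]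
          exact hw _ (List.getElem_mem _)
        · rw [List.getD_eq_default _ _ (by omega)]
          decide
    · rintro ⟨x, hxw, hx⟩ a ha
      obtain ⟨i, hi, rfl⟩ := List.getElem_of_mem ha
      rw [← mem_cyl_iff_getElem.1 hxw i hi]
      exact hx i
  have hp : PrimrecPred fun w : List (Fin 3 × Fin 2) => ∀ a ∈ w, a ≠ marker :=
    (Primrec.eq.comp Primrec.id (Primrec.const marker)).not.forall_mem_list
  obtain ⟨_, hd⟩ := hp.of_eq h
  exact ⟨_, hd.to_comp⟩

/-- Wild attractors II: a computable map of the Cantor space over the alphabet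
`{0,1,S} × {a,b}` (i.e. `Fin 3 × Fin 2`) whose metric attractor (w.r.t. the uniform Bernoulli
product measure) has a Π₂-complete inner collection, while its topological attractor has a
decidable inner collection. -/
theorem stmt15 :
    ∃ (T'' : (ℕ → Fin 3 × Fin 2) → (ℕ → Fin 3 × Fin 2))
      (Am At : Set (ℕ → Fin 3 × Fin 2)),
      CantorComputable T'' ∧
      -- (i) metric attractor with Π₂-complete inner collection
      (∀ lam : Measure (ℕ → Fin 3 × Fin 2), IsProbabilityMeasure lam →
        (∀ w : List (Fin 3 × Fin 2),
          lam (cyl w) = ((Fintype.card (Fin 3 × Fin 2) : ℝ≥0∞))⁻¹ ^ w.length) →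
        IsMetricAttractor T'' lam Am) ∧
      PiTwo {w : List (Fin 3 × Fin 2) | (cyl w ∩ Am).Nonempty} ∧
      ((fun e : ℕ => e ∈ TotSet) ≤₀
        fun w : List (Fin 3 × Fin 2) => (cyl w ∩ Am).Nonempty) ∧
      -- (ii) topological attractor with decidable inner collection
      IsTopAttractor T'' At ∧
      ComputablePred (fun w : List (Fin 3 × Fin 2) => (cyl w ∩ At).Nonempty) := by
  exact ⟨sweepMap haltingSeq, omegaSet shiftMap haltingSeq, markerFree,
    cantorComputable_sweepMap primrec_haltingSeq,
    fun _ _ hlam => isMetricAttractor_omegaSet_shiftMap haltingSeq_ne_marker hlam,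
    piTwo_cyl_inter_omegaSet_shiftMap primrec_haltingSeq,
    ⟨indexWord, primrec_indexWord.to_comp, fun _ => mem_totSet_iff_indexWord⟩,
    isTopAttractor_markerFree haltingSeq_ne_marker,
    computablePred_cyl_inter_markerFree⟩
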